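/- arXiv:math/9501224 — 4 statements merged into one kernel-verified Lean document; each statement's English description precedes it below -/
import Mathlib

section
/- For n ≥ 1, let K be the (n+1)×(n+1) real matrix (rows and columns indexed by 0, 1, …, n) whose only nonzero entries are K_{i,i+1} = n − i and K_{i+1,i} = i + 1 for i = 0, …, n−1 (the Kac matrix). Then the eigenvalues of K are exactly the n+1 integers n − 2k for k = 0, 1, …, n, each with multiplicity one; equivalently, the characteristic polynomial of K is ∏_{k=0}^n (X − (n − 2k)). (Section 4.3.) -/
open Polynomial

/-- The polynomial `(1 - X) ^ k * (1 + X) ^ m`, whose coefficients form a left eigenvector of the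
Kac matrix of size `k + m + 1` for the eigenvalue `m - k`. -/
noncomputable def kacPoly (k m : ℕ) : ℝ[X] := (1 - X) ^ k * (1 + X) ^ m

theorem kacPoly_differential_eq (k m : ℕ) :
    (1 - X ^ 2) * derivative (kacPoly k m) =
      (C ((m : ℝ) - k) - C ((m : ℝ) + k) * X) * kacPoly k m := by
  have h1 : (1 - X) * derivative ((1 - X : ℝ[X]) ^ k) = -C (k : ℝ) * (1 - X) ^ k := by
    cases k with
    | zero => simp
    | succ k => simp [derivative_pow]; ring
  have h2 : (1 + X) * derivative ((1 + X : ℝ[X]) ^ m) = C (m : ℝ) * (1 + X) ^ m := by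
    cases m with
    | zero => simp
    | succ m => simp [derivative_pow]; ring
  simp only [kacPoly, derivative_mul, C_add, C_sub]
  linear_combination (1 + X) * (1 + X) ^ m * h1 + (1 - X) * (1 - X) ^ k * h2

theorem natDegree_kacPoly_le (k m : ℕ) : (kacPoly k m).natDegree ≤ k + m := by
  unfold kacPoly
  compute_degree

theorem kacPoly_coeff_zero (k m : ℕ) : (kacPoly k m).coeff 0 = 1 := by
  simp [kacPoly, coeff_zero_eq_eval_zero]

theorem kacPoly_coeff_one (k m : ℕ) :
    (kacPoly k m).coeff 1 = (m : ℝ) - k := by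
  have h := congrArg (fun p => coeff p 0) (kacPoly_differential_eq k m)
  simpa [mul_coeff_zero, coeff_derivative, kacPoly_coeff_zero] using h

theorem kacPoly_coeff_recurrence (k m j : ℕ) :
    (kacPoly k m).coeff j * ((m : ℝ) + k - j) + (kacPoly k m).coeff (j + 2) * (j + 2) =
      ((m : ℝ) - k) * (kacPoly k m).coeff (j + 1) := by
  have h := congrArg (fun p => coeff p (j + 1)) (kacPoly_differential_eq k m)
  simp only [sub_mul, one_mul, mul_assoc, coeff_sub, coeff_C_mul, coeff_X_mul, pow_two,
    coeff_derivative] at h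
  cases j with
  | zero =>
    simp [mul_coeff_zero, coeff_derivative] at h ⊢
    linear_combination h
  | succ j =>
    simp [coeff_derivative] at h ⊢
    linear_combination h

theorem sum_kacPoly_coeff_mul (k m j : ℕ) (hj : j ≤ k + m) :
    ∑ i ∈ Finset.range (k + m + 1), (kacPoly k m).coeff i *
      (if j = i + 1 then ((k + m : ℕ) : ℝ) - i else if i = j + 1 then (i : ℝ) else 0) =
      ((m : ℝ) - k) * (kacPoly k m).coeff j := by
  have hsplit : ∀ i : ℕ, (kacPoly k m).coeff i *
      (if j = i + 1 then ((k + m : ℕ) : ℝ) - i else if i = j + 1 then (i : ℝ) else 0) =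
      (if j = i + 1 then (kacPoly k m).coeff i * (((k + m : ℕ) : ℝ) - i) else 0) +
      (if i = j + 1 then (kacPoly k m).coeff i * (i : ℝ) else 0) := by
    intro i
    split_ifs <;> first | omega | simp
  have hup : ∑ i ∈ Finset.range (k + m + 1),
      (if i = j + 1 then (kacPoly k m).coeff i * (i : ℝ) else 0) =
      (kacPoly k m).coeff (j + 1) * (j + 1) := by
    rw [Finset.sum_ite_eq']
    split_ifs with h
    · push_cast; rfl
    · rw [coeff_eq_zero_of_natDegree_lt, zero_mul]
      have := natDegree_kacPoly_le k m
      rw [Finset.mem_range] at h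
      omega
  rw [Finset.sum_congr rfl fun i _ => hsplit i, Finset.sum_add_distrib, hup]
  cases j with
  | zero => simp [kacPoly_coeff_zero, kacPoly_coeff_one]
  | succ j =>
    simp only [add_left_inj]
    rw [Finset.sum_ite_eq, if_pos (Finset.mem_range.2 (by omega)), ← kacPoly_coeff_recurrence]
    push_cast
    ring

/-- Section 4.3: the Kac matrix, the `(n+1)×(n+1)` tridiagonal matrix with zero
diagonal, superdiagonal entries `K_{i,i+1} = n - i` and subdiagonal entries
`K_{i+1,i} = i + 1`, has characteristic polynomial `∏_{k=0}^{n} (X - (n - 2k))`;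
equivalently its eigenvalues are exactly `n - 2k`, `k = 0, …, n`, each simple. -/
theorem kac_matrix_charpoly (n : ℕ) (hn : 1 ≤ n)
    (K : Matrix (Fin (n + 1)) (Fin (n + 1)) ℝ)
    (hK : ∀ i j : Fin (n + 1), K i j =
      if (j : ℕ) = (i : ℕ) + 1 then (n : ℝ) - (i : ℕ)
      else if (i : ℕ) = (j : ℕ) + 1 then (i : ℕ)
      else 0) :
    K.charpoly = ∏ k ∈ Finset.range (n + 1), (X - C ((n : ℝ) - 2 * k)) := by
  have hroot : ∀ k ∈ Finset.range (n + 1), X - C ((n : ℝ) - 2 * k) ∣ K.charpoly := by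
    intro k hk
    obtain ⟨m, rfl⟩ := Nat.exists_eq_add_of_le (Nat.lt_succ_iff.1 (Finset.mem_range.1 hk))
    rw [dvd_iff_isRoot, IsRoot.def, Matrix.eval_charpoly, ← Matrix.exists_vecMul_eq_zero_iff]
    refine ⟨fun i => (kacPoly k m).coeff i, fun h => ?_, ?_⟩
    · have h0 := congrFun h 0
      simp [kacPoly_coeff_zero] at h0
    · ext j
      have hj := sum_kacPoly_coeff_mul k m j (Nat.lt_succ_iff.1 j.2)
      rw [Finset.sum_range] at hj
      rw [Matrix.vecMul_sub, Pi.sub_apply, Pi.zero_apply, sub_eq_zero, Matrix.scalar_apply,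
        Matrix.vecMul_diagonal]
      simp only [Matrix.vecMul, dotProduct, hK]
      rw [hj]
      push_cast
      ring
  have hinj : Function.Injective fun k : ℕ => (n : ℝ) - 2 * k := by
    intro a b h
    simpa using h
  have hdvd : ∏ k ∈ Finset.range (n + 1), (X - C ((n : ℝ) - 2 * k)) ∣ K.charpoly :=
    Finset.prod_dvd_of_coprime ((pairwise_coprime_X_sub_C hinj).set_pairwise _) hroot
  refine eq_of_monic_of_dvd_of_natDegree_le (monic_prod_X_sub_C _ _) K.charpoly_monic hdvd ?_
  rw [natDegree_finsetProd_X_sub_C_eq_card, K.charpoly_natDegree_eq_dim]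
  simp
end

section
/- Let n ≥ 0 and let v : ℝ → ℝ^(n+1) be a differentiable curve with v(t) ≠ 0 for all t, and set γ(t) = v(t)/‖v(t)‖. Then for every t, ‖γ′(t)‖² = ( (v(t)·v(t))·(v′(t)·v′(t)) − (v(t)·v′(t))² ) / (v(t)·v(t))². Consequently ‖γ′(t)‖² equals the mixed second derivative ∂²/∂x∂y of log( v(x)·v(y) ) evaluated at y = x = t. (Identity (3), Section 2.3; the Fubini–Study metric identity.) -/
open Real
open scoped RealInnerProductSpace

section InnerProductCurve

variable {E : Type*} [NormedAddCommGroup E] [InnerProductSpace ℝ E] {v : ℝ → E} {w : E} {t : ℝ}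

theorem hasDerivAt_norm_of_ne_zero (hv : HasDerivAt v w t) (h0 : v t ≠ 0) :
    HasDerivAt (fun s => ‖v s‖) (⟪v t, w⟫ / ‖v t‖) t := by
  have hr : ‖v t‖ ≠ 0 := norm_ne_zero_iff.mpr h0
  have h := hv.norm_sq.sqrt (pow_ne_zero 2 hr)
  simp only [Real.sqrt_sq (norm_nonneg _)] at h
  convert h using 1
  field_simp

theorem hasDerivAt_inv_norm_smul (hv : HasDerivAt v w t) (h0 : v t ≠ 0) :
    HasDerivAt (fun s => ‖v s‖⁻¹ • v s)
      (‖v t‖⁻¹ • w + (-(⟪v t, w⟫ / ‖v t‖) / ‖v t‖ ^ 2) • v t) t :=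
  ((hasDerivAt_norm_of_ne_zero hv h0).fun_inv (norm_ne_zero_iff.mpr h0)).fun_smul hv

theorem norm_sq_deriv_inv_norm_smul (hv : HasDerivAt v w t) (h0 : v t ≠ 0) :
    ‖deriv (fun s => ‖v s‖⁻¹ • v s) t‖ ^ 2 =
      (⟪v t, v t⟫ * ⟪w, w⟫ - ⟪v t, w⟫ ^ 2) / ⟪v t, v t⟫ ^ 2 := by
  have hr : ‖v t‖ ≠ 0 := norm_ne_zero_iff.mpr h0
  rw [(hasDerivAt_inv_norm_smul hv h0).deriv, norm_add_sq_real, norm_smul, norm_smul,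
    real_inner_smul_left, real_inner_smul_right, real_inner_comm, mul_pow, mul_pow,
    real_inner_self_eq_norm_sq, real_inner_self_eq_norm_sq, Real.norm_eq_abs, Real.norm_eq_abs,
    sq_abs, sq_abs]
  field_simp
  ring

theorem deriv_deriv_log_inner (hv : HasDerivAt v w t) (h0 : v t ≠ 0) :
    deriv (fun x => deriv (fun y => Real.log ⟪v x, v y⟫) t) t =
      (⟪v t, v t⟫ * ⟪w, w⟫ - ⟪v t, w⟫ ^ 2) / ⟪v t, v t⟫ ^ 2 := by
  have hne : ⟪v t, v t⟫ ≠ 0 := inner_self_ne_zero.mpr h0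
  have hleft (u : E) : HasDerivAt (fun x => ⟪v x, u⟫) ⟪w, u⟫ t := by
    simpa using hv.inner ℝ (hasDerivAt_const t u)
  have hright (u : E) : HasDerivAt (fun y => ⟪u, v y⟫) ⟪u, w⟫ t := by
    simpa using (hasDerivAt_const t u).inner ℝ hv
  have hev : (fun x => deriv (fun y => Real.log ⟪v x, v y⟫) t) =ᶠ[nhds t]
      fun x => ⟪v x, w⟫ / ⟪v x, v t⟫ := by
    filter_upwards [(hleft (v t)).continuousAt.eventually_ne hne] with x hx
    exact ((hright (v x)).log hx).deriv
  rw [hev.deriv_eq, ((hleft w).fun_div (hleft (v t)) hne).deriv, real_inner_comm (v t) w]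
  ring

end InnerProductCurve

/-- Identity (3) of Section 2.3 (the Fubini–Study metric identity): for a nonvanishing
differentiable curve `v` with spherical projection `γ = v/‖v‖`,
`‖γ'(t)‖² = ((v·v)(v'·v') - (v·v')²)/(v·v)²`, and this equals the mixed second
derivative `∂²/∂x∂y log(v(x)·v(y))` at `y = x = t`. -/
theorem fubini_study_identity (n : ℕ)
    (v : ℝ → EuclideanSpace ℝ (Fin (n + 1)))
    (hv : Differentiable ℝ v) (hv0 : ∀ t, v t ≠ 0)
    (γ : ℝ → EuclideanSpace ℝ (Fin (n + 1)))
    (hγ : ∀ t, γ t = ‖v t‖⁻¹ • v t) :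
    ∀ t : ℝ,
      ‖deriv γ t‖ ^ 2 =
        (⟪v t, v t⟫ * ⟪deriv v t, deriv v t⟫ - ⟪v t, deriv v t⟫ ^ 2)
          / ⟪v t, v t⟫ ^ 2 ∧
      ‖deriv γ t‖ ^ 2 =
        deriv (fun x => deriv (fun y => Real.log ⟪v x, v y⟫) t) t := by
  obtain rfl : γ = fun s => ‖v s‖⁻¹ • v s := funext hγ
  intro t
  have h := norm_sq_deriv_inv_norm_smul (hv t).hasDerivAt (hv0 t)
  exact ⟨h, h.trans (deriv_deriv_log_inner (hv t).hasDerivAt (hv0 t)).symm⟩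
end

section
/- Let n ≥ 0, let f₀, …, fₙ : ℝ → ℝ be differentiable, set v(t) = (f₀(t), …, fₙ(t)), and assume v(t) ≠ 0 and γ′(t) ≠ 0 for all t, where γ(t) = v(t)/‖v(t)‖. Let m = (m₀, …, mₙ) ∈ ℝ^(n+1), and let a₀, …, aₙ be independent normal real random variables with aᵢ having mean mᵢ and variance 1. Define m₀(t) = m·γ(t) and m₁(t) = m·γ′(t)/‖γ′(t)‖. Then for every measurable set I ⊆ ℝ, the expected number of solutions t ∈ I of a₀f₀(t) + ⋯ + aₙfₙ(t) = 0 equals ∫_I ρₙ(t) dt, where ρₙ(t) = (1/π)·‖γ′(t)‖·e^(−m₀(t)²/2)·( e^(−m₁(t)²/2) + √(π/2)·m₁(t)·erf(m₁(t)/√2) ). (Theorem 5.2.) -/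
open MeasureTheory ProbabilityTheory Real Set
open scoped ENNReal NNReal

/-- The error function `erf(x) = (2/√π) ∫₀ˣ e^{-s²} ds`. -/
noncomputable def erf (x : ℝ) : ℝ :=
  (2 / Real.sqrt π) * ∫ s in (0 : ℝ)..x, Real.exp (-s ^ 2)

theorem lintegral_pi_insertNth {n : ℕ} (μ : Fin (n + 1) → Measure ℝ) [∀ i, SigmaFinite (μ i)]
    (j : Fin (n + 1)) {F : (Fin (n + 1) → ℝ) → ℝ≥0∞} (hF : Measurable F) :
    ∫⁻ a, F a ∂(Measure.pi μ) = ∫⁻ p, F (j.insertNth (α := fun _ => ℝ) p.1 p.2)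
      ∂((μ j).prod (Measure.pi fun k => μ (j.succAbove k))) :=
  ((measurePreserving_piFinSuccAbove μ j).symm.lintegral_comp hF).symm

theorem measurable_insertNth {n : ℕ} (j : Fin (n + 1)) :
    Measurable fun p : ℝ × (Fin n → ℝ) => j.insertNth (α := fun _ => ℝ) p.1 p.2 :=
  (MeasurableEquiv.piFinSuccAbove (fun _ => ℝ) j).symm.measurable

theorem lintegral_pi_fin_prod {n : ℕ} (μ : Fin n → Measure ℝ) [∀ i, SigmaFinite (μ i)]
    (f : Fin n → ℝ → ℝ≥0∞) (hf : ∀ i, Measurable (f i)) :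
    ∫⁻ a, ∏ i, f i (a i) ∂(Measure.pi μ) = ∏ i, ∫⁻ x, f i x ∂(μ i) := by
  induction n with
  | zero => simp
  | succ n ih =>
    rw [lintegral_pi_insertNth μ 0 (by fun_prop), Fin.prod_univ_succ,
      ← ih (fun i => μ i.succ) (fun i => f i.succ) fun i => hf _,
      ← lintegral_prod_mul (hf 0).aemeasurable
        (by fun_prop : Measurable fun a : Fin n → ℝ => ∏ i, f i.succ (a i)).aemeasurable]
    simp [Fin.prod_univ_succ]

theorem pi_withDensity_fin {n : ℕ} (μ : Fin n → Measure ℝ) [∀ i, SigmaFinite (μ i)]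
    (f : Fin n → ℝ → ℝ≥0∞) (hf : ∀ i, Measurable (f i))
    [∀ i, SigmaFinite ((μ i).withDensity (f i))] :
    Measure.pi (fun i => (μ i).withDensity (f i)) =
      (Measure.pi μ).withDensity fun a => ∏ i, f i (a i) := by
  refine Measure.pi_eq fun s hs => ?_
  rw [withDensity_apply _ (MeasurableSet.univ_pi hs), Measure.restrict_pi_pi,
    lintegral_pi_fin_prod _ _ hf]
  exact Finset.prod_congr rfl fun i _ => (withDensity_apply _ (hs i)).symm

section AreaFormula

variable {E : Type*} [NormedAddCommGroup E] [NormedSpace ℝ E] [FiniteDimensional ℝ E]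

theorem exists_approximatesLinearOn_injOn (A : E →L[ℝ] E) :
    ∃ r : ℝ≥0, r ≠ 0 ∧ (A.det ≠ 0 → ∀ (Φ : E → E) (s : Set E),
      ApproximatesLinearOn Φ A s r → InjOn Φ s) := by
  by_cases hA : A.det = 0
  · exact ⟨1, one_ne_zero, fun h => absurd hA h⟩
  rcases subsingleton_or_nontrivial E with hE | hE
  · exact ⟨1, one_ne_zero, fun _ Φ s _ => Set.injOn_of_subsingleton Φ s⟩
  · let B := A.toContinuousLinearEquivOfDetNeZero hA
    have hB : 0 < ‖(B.symm : E →L[ℝ] E)‖₊⁻¹ := by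
      exact inv_pos.2 B.nnnorm_symm_pos
    obtain ⟨r, hr0, hr⟩ := exists_between hB
    refine ⟨r, hr0.ne', fun _ Φ s h => ?_⟩
    have h' : ApproximatesLinearOn Φ (B : E →L[ℝ] E) s r := by simpa [B] using h
    exact h'.injOn (Or.inr hr)

variable [MeasurableSpace E] [BorelSpace E]

theorem lintegral_encard_fiber_mul (μ : Measure E) [μ.IsAddHaarMeasure] {s : Set E} {Φ : E → E}
    {Φ' : E → E →L[ℝ] E} (hs : MeasurableSet s)
    (hΦ : ∀ x ∈ s, HasFDerivWithinAt Φ (Φ' x) s x)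
    (hdet : MeasurableSet {x | x ∈ s ∧ (Φ' x).det ≠ 0}) {w : E → ℝ≥0∞} (hw : Measurable w) :
    AEMeasurable (fun a => ((s ∩ Φ ⁻¹' {a}).encard : ℝ≥0∞) * w a) μ ∧
    ∫⁻ a, ((s ∩ Φ ⁻¹' {a}).encard : ℝ≥0∞) * w a ∂μ =
      ∫⁻ x in s, ENNReal.ofReal |(Φ' x).det| * w (Φ x) ∂μ := by
  set s₁ : Set E := {x | x ∈ s ∧ (Φ' x).det ≠ 0} with hs₁
  have hs₁s : s₁ ⊆ s := fun x hx => hx.1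
  have hΦ₁ : ∀ x ∈ s₁, HasFDerivWithinAt Φ (Φ' x) s₁ x := fun x hx => (hΦ x hx.1).mono hs₁s
  have hnull : μ (Φ '' (s \ s₁)) = 0 := by
    refine addHaar_image_eq_zero_of_det_fderivWithin_eq_zero μ (f' := Φ')
      (fun x hx => (hΦ x hx.1).mono sdiff_subset) fun x hx => ?_
    by_contra h
    exact hx.2 ⟨hx.1, h⟩
  choose r hr0 hr using exists_approximatesLinearOn_injOn (E := E)
  obtain ⟨t, A, htd, htm, hst, hA, hAy⟩ :=
    exists_partition_approximatesLinearOn_of_hasFDerivWithinAt Φ s₁ Φ' hΦ₁ r hr0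
  set S : ℕ → Set E := fun k => s₁ ∩ t k with hS
  have hSm : ∀ k, MeasurableSet (S k) := fun k => hdet.inter (htm k)
  have hSd : Pairwise (Function.onFun Disjoint S) := fun i j hij =>
    (htd hij).mono inter_subset_right inter_subset_right
  have hSU : ⋃ k, S k = s₁ := by
    rw [hS, ← inter_iUnion, inter_eq_left]; exact hst
  have hSi : ∀ k, InjOn Φ (S k) := fun k => by
    rcases s₁.eq_empty_or_nonempty with he | hne
    · simp [hS, he]
    · obtain ⟨y, hy, hAk⟩ := hAy hne k
      exact hr (A k) (hAk ▸ hy.2) Φ _ (hA k)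
  have hΦS : ∀ k, ∀ x ∈ S k, HasFDerivWithinAt Φ (Φ' x) (S k) x := fun k x hx =>
    (hΦ₁ x hx.1).mono inter_subset_left
  have him : ∀ k, MeasurableSet (Φ '' S k) := fun k =>
    measurable_image_of_fderivWithin (hSm k) (hΦS k) (hSi k)
  have hcount : ∀ a ∉ Φ '' (s \ s₁),
      ((s ∩ Φ ⁻¹' {a}).encard : ℝ≥0∞) * w a = ∑' k, (Φ '' S k).indicator w a := by
    intro a ha
    have hsub : ∀ k, (S k ∩ Φ ⁻¹' {a}).Subsingleton := fun k x hx y hy =>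
      hSi k hx.1 hy.1 (hx.2.trans hy.2.symm)
    have hfib : s ∩ Φ ⁻¹' {a} = ⋃ k, S k ∩ Φ ⁻¹' {a} := by
      rw [← iUnion_inter, hSU]
      ext x
      refine ⟨fun hx => ⟨?_, hx.2⟩, fun hx => ⟨hs₁s hx.1, hx.2⟩⟩
      by_contra h
      exact ha ⟨x, ⟨hx.1, h⟩, hx.2⟩
    have hmk : ∀ k, MeasurableSet (S k ∩ Φ ⁻¹' {a}) := fun k => (hsub k).measurableSet
    rw [← Measure.count_apply (by rw [hfib]; exact MeasurableSet.iUnion hmk), hfib,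
      measure_iUnion (fun i j hij => (hSd hij).mono inter_subset_left inter_subset_left) hmk,
      ← ENNReal.tsum_mul_right]
    refine tsum_congr fun k => ?_
    rw [Measure.count_apply (hmk k)]
    by_cases hk : a ∈ Φ '' S k
    · obtain ⟨x, hx, rfl⟩ := hk
      have : S k ∩ Φ ⁻¹' {Φ x} = {x} := (hsub k).eq_singleton_of_mem ⟨hx, rfl⟩
      rw [this, indicator_of_mem (mem_image_of_mem _ hx)]
      simp
    · have : S k ∩ Φ ⁻¹' {a} = ∅ := by
        ext x; simp only [mem_inter_iff, mem_preimage, mem_singleton_iff, mem_empty_iff_false,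
          iff_false, not_and]
        exact fun hx hxa => hk ⟨x, hx, hxa⟩
      simp [this, hk]
  have hae : (fun a => ((s ∩ Φ ⁻¹' {a}).encard : ℝ≥0∞) * w a) =ᵐ[μ]
      fun a => ∑' k, (Φ '' S k).indicator w a := by
    filter_upwards [compl_mem_ae_iff.2 hnull] with a ha using hcount a ha
  have hmeas : ∀ k, Measurable ((Φ '' S k).indicator w) := fun k => hw.indicator (him k)
  refine ⟨(Measurable.tsum hmeas).aemeasurable.congr hae.symm, ?_⟩
  have hzero : ∫⁻ x in s \ s₁, ENNReal.ofReal |(Φ' x).det| * w (Φ x) ∂μ = 0 := by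
    rw [setLIntegral_congr_fun (g := fun _ => 0) (hs.diff hdet), lintegral_zero]
    intro x hx
    have : (Φ' x).det = 0 := by
      by_contra h
      exact hx.2 ⟨hx.1, h⟩
    simp [this]
  rw [lintegral_congr_ae hae, lintegral_tsum fun k => (hmeas k).aemeasurable,
    ← lintegral_inter_add_sdiff _ s hdet, hzero, add_zero, inter_eq_right.2 hs₁s, ← hSU,
    lintegral_iUnion hSm hSd]
  refine tsum_congr fun k => ?_
  rw [lintegral_indicator (him k),
    lintegral_image_eq_lintegral_abs_det_fderiv_mul μ (hSm k) (hΦS k) (hSi k)]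

end AreaFormula

theorem integral_exp_neg_sq_div_two_eq_erf (x : ℝ) :
    ∫ s in (0 : ℝ)..x, exp (-s ^ 2 / 2) = √(π / 2) * erf (x / √2) := by
  have h2 : (√2 : ℝ) ≠ 0 := by positivity
  have hπ : (√π : ℝ) ≠ 0 := by positivity
  have h := intervalIntegral.integral_comp_div (a := 0) (b := x)
    (fun s => exp (-s ^ 2)) h2
  have he : ∀ s : ℝ, exp (-(s / √2) ^ 2) = exp (-s ^ 2 / 2) := fun s => by
    rw [div_pow, Real.sq_sqrt (by norm_num), neg_div]
  simp only [he, zero_div] at h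
  rw [h, erf, Real.sqrt_div pi_pos.le, smul_eq_mul]
  field_simp
  rw [Real.sq_sqrt (by norm_num), mul_comm]

theorem integral_Ioi_mul_exp_add_exp (μ : ℝ) :
    ∫ x in Ioi (0 : ℝ), x * (exp (-(x - μ) ^ 2 / 2) + exp (-(x + μ) ^ 2 / 2)) =
      2 * exp (-μ ^ 2 / 2) + 2 * μ * ∫ s in (0 : ℝ)..μ, exp (-s ^ 2 / 2) := by
  set G : ℝ → ℝ := fun x => ∫ s in (0 : ℝ)..x, exp (-s ^ 2 / 2) with hG
  have hint : Integrable fun s : ℝ => exp (-s ^ 2 / 2) := by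
    refine (integrable_exp_neg_mul_sq (b := 1 / 2) (by norm_num)).congr (ae_of_all _ fun s => ?_)
    simp only []
    ring_nf
  have hGd : ∀ x, HasDerivAt G (exp (-x ^ 2 / 2)) x := fun x =>
    (by fun_prop : Continuous fun s : ℝ => exp (-s ^ 2 / 2)).integral_hasStrictDerivAt 0 x
      |>.hasDerivAt
  have hGt : Filter.Tendsto G Filter.atTop (nhds (∫ s in Ioi (0 : ℝ), exp (-s ^ 2 / 2))) :=
    intervalIntegral_tendsto_integral_Ioi 0 hint.integrableOn Filter.tendsto_id
  have hexp : Filter.Tendsto (fun x : ℝ => exp (-x ^ 2 / 2)) Filter.atTop (nhds 0) := by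
    refine Real.tendsto_exp_atBot.comp ?_
    have : (fun x : ℝ => -x ^ 2 / 2) = fun x => -(x ^ 2 / 2) := by ext; ring
    rw [this]
    exact Filter.tendsto_neg_atTop_atBot.comp
      ((Filter.tendsto_pow_atTop two_ne_zero).atTop_div_const two_pos)
  have hp : Filter.Tendsto (fun x => x + μ) Filter.atTop Filter.atTop :=
    Filter.tendsto_atTop_add_const_right _ _ Filter.tendsto_id
  have hm : Filter.Tendsto (fun x => x - μ) Filter.atTop Filter.atTop :=
    Filter.tendsto_atTop_add_const_right _ _ Filter.tendsto_id
  have hGodd : G (-μ) = -G μ := by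
    have h := intervalIntegral.integral_comp_neg (a := 0) (b := μ) (fun s => exp (-s ^ 2 / 2))
    simp only [neg_sq, neg_zero] at h
    simp only [hG]
    rw [h, intervalIntegral.integral_symm]
  have key := integral_Ioi_of_hasDerivAt_of_nonneg' (a := 0) (l := 0)
    (g := fun x => -exp (-(x - μ) ^ 2 / 2) - exp (-(x + μ) ^ 2 / 2)
      + μ * (G (x - μ) - G (x + μ)))
    (g' := fun x => x * (exp (-(x - μ) ^ 2 / 2) + exp (-(x + μ) ^ 2 / 2))) ?_ ?_ ?_
  · rw [key]
    simp only [zero_sub, zero_add, hGodd, neg_sq]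
    ring
  · intro x _
    have d1 : HasDerivAt (fun x => exp (-(x - μ) ^ 2 / 2))
        (exp (-(x - μ) ^ 2 / 2) * (-(2 * (x - μ)) / 2)) x := by
      simpa using ((((hasDerivAt_id x).sub_const μ).pow 2).neg.div_const 2).exp
    have d2 : HasDerivAt (fun x => exp (-(x + μ) ^ 2 / 2))
        (exp (-(x + μ) ^ 2 / 2) * (-(2 * (x + μ)) / 2)) x := by
      simpa using ((((hasDerivAt_id x).add_const μ).pow 2).neg.div_const 2).exp
    have d3 : HasDerivAt (fun x => G (x - μ)) (exp (-(x - μ) ^ 2 / 2)) x := by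
      exact (hGd (x - μ)).comp_sub_const x μ
    have d4 : HasDerivAt (fun x => G (x + μ)) (exp (-(x + μ) ^ 2 / 2)) x := by
      exact (hGd (x + μ)).comp_add_const x μ
    exact ((d1.neg.sub d2).add ((d3.sub d4).const_mul μ)).congr_deriv (by ring)
  · intro x hx
    have : (0 : ℝ) < x := hx
    positivity
  · simpa using ((hexp.comp hm).neg.sub (hexp.comp hp)).add
      (((hGt.comp hm).sub (hGt.comp hp)).const_mul μ)

theorem lintegral_abs_gaussianReal (μ : ℝ) :
    ∫⁻ x, ENNReal.ofReal |x| ∂(gaussianReal μ 1) =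
      ENNReal.ofReal (2 / √(2 * π) *
        (exp (-μ ^ 2 / 2) + √(π / 2) * μ * erf (μ / √2))) := by
  have hint : Integrable (fun x : ℝ => |x|) (gaussianReal μ 1) :=
    ((memLp_id_gaussianReal' (μ := μ) (v := 1) 1 (by simp)).integrable le_rfl).abs
  rw [← ofReal_integral_eq_lintegral_ofReal hint (ae_of_all _ fun x => abs_nonneg x)]
  congr 1
  set p : ℝ → ℝ := gaussianPDFReal μ 1 with hp
  have hpe : ∀ x, p x = (√(2 * π))⁻¹ * exp (-(x - μ) ^ 2 / 2) := fun x => by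
    simp [hp, gaussianPDFReal]
  have hpint : Integrable fun x => p x * |x| := by
    rw [gaussianReal_of_var_ne_zero μ one_ne_zero,
      integrable_withDensity_iff_integrable_smul' (measurable_gaussianPDF μ 1)
        (ae_of_all _ fun x => gaussianPDF_lt_top)] at hint
    simpa [toReal_gaussianPDF] using hint
  have hneg : ∫ x, p (-x) * |x| = ∫ x, p x * |x| := by
    simpa using integral_neg_eq_self (fun x => p x * |x|) volume
  have hnint : Integrable fun x => p (-x) * |x| := by simpa using hpint.comp_neg
  have heven : ∀ x, p x * |x| + p (-x) * |x| =
      (√(2 * π))⁻¹ * (|x| * (exp (-(|x| - μ) ^ 2 / 2) + exp (-(|x| + μ) ^ 2 / 2))) := by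
    intro x
    rw [hpe, hpe]
    rcases abs_cases x with ⟨h, -⟩ | ⟨h, -⟩ <;> rw [h] <;> ring_nf
  have h2 : 2 * ∫ x, p x * |x| = 2 * ((√(2 * π))⁻¹ * ∫ x in Ioi (0 : ℝ),
      x * (exp (-(x - μ) ^ 2 / 2) + exp (-(x + μ) ^ 2 / 2))) := by
    calc 2 * ∫ x, p x * |x| = ∫ x, (p x * |x| + p (-x) * |x|) := by
          rw [integral_add hpint hnint, hneg, two_mul]
      _ = ∫ x, (fun u => (√(2 * π))⁻¹ *
            (u * (exp (-(u - μ) ^ 2 / 2) + exp (-(u + μ) ^ 2 / 2)))) |x| :=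
          integral_congr_ae (ae_of_all _ heven)
      _ = _ := by
          rw [integral_comp_abs (f := fun u => (√(2 * π))⁻¹ *
            (u * (exp (-(u - μ) ^ 2 / 2) + exp (-(u + μ) ^ 2 / 2)))), integral_const_mul]
  rw [integral_gaussianReal_eq_integral_smul one_ne_zero]
  simp only [smul_eq_mul]
  rw [mul_left_cancel₀ two_ne_zero h2, integral_Ioi_mul_exp_add_exp,
    integral_exp_neg_sq_div_two_eq_erf]
  ring

theorem map_sum_mul_pi_gaussianReal {n : ℕ} (m u : Fin n → ℝ) (hu : ∑ i, u i ^ 2 = 1) :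
    (Measure.pi fun i => gaussianReal (m i) 1).map (fun a => ∑ i, a i * u i) =
      gaussianReal (∑ i, m i * u i) 1 := by
  set P := Measure.pi fun i => gaussianReal (m i) 1 with hP
  have hmem : ∀ i, MemLp (fun x : ℝ => x * u i) 2 (gaussianReal (m i) 1) := fun i =>
    (memLp_id_gaussianReal' (μ := m i) (v := 1) 2 (by simp)).mul_const (u i)
  have hind : iIndepFun (fun i (a : Fin n → ℝ) => a i * u i) P :=
    iIndepFun_pi (X := fun i x => x * u i) fun i => by fun_prop
  have hX : ∀ i, P.map (fun a => a i * u i) =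
      gaussianReal (u i * m i) (NNReal.mk (u i ^ 2) (sq_nonneg _) * 1) :=
    fun i => by
      have := gaussianReal_map_mul_const (μ := m i) (v := 1) (u i)
      rw [← this, ← (measurePreserving_eval (fun i => gaussianReal (m i) 1) i).map_eq,
        Measure.map_map (by fun_prop) (by fun_prop)]
      rfl
  have hlaw : HasGaussianLaw (fun a : Fin n → ℝ => ∑ i, a i * u i) P := by
    refine iIndepFun.hasGaussianLaw_fun_sum (fun i => ⟨?_⟩) hind
    rw [hX]
    infer_instance
  rw [hlaw.map_eq_gaussianReal]
  congr 1
  · rw [integral_finsetSum]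
    · refine Finset.sum_congr rfl fun i _ => ?_
      rw [integral_comp_eval (μ := fun i => gaussianReal (m i) 1) (f := fun x => x * u i)
        (by fun_prop), integral_mul_const, integral_id_gaussianReal]
    · exact fun i _ => ((hmem i).comp_measurePreserving
        (measurePreserving_eval _ i)).integrable one_le_two
  · have h := variance_sum_pi hmem
    have h' : (∑ i, fun a : Fin n → ℝ => a i * u i) = fun a => ∑ i, a i * u i := by
      ext a; simp
    rw [h'] at h
    rw [h]
    simp [variance_mul_const, hu]

theorem lintegral_abs_sum_mul_pi_gaussianReal {n : ℕ} (m u : Fin n → ℝ) (hu : ∑ i, u i ^ 2 = 1) :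
    ∫⁻ a, ENNReal.ofReal |∑ i, a i * u i| ∂(Measure.pi fun i => gaussianReal (m i) 1) =
      ENNReal.ofReal (2 / √(2 * π) * (exp (-(∑ i, m i * u i) ^ 2 / 2) +
        √(π / 2) * (∑ i, m i * u i) * erf ((∑ i, m i * u i) / √2))) := by
  rw [← lintegral_abs_gaussianReal, ← map_sum_mul_pi_gaussianReal m u hu,
    lintegral_map (by fun_prop) (by fun_prop)]

theorem prod_gaussianPDF_one {n : ℕ} (m a : Fin n → ℝ) :
    ∏ i, gaussianPDF (m i) 1 (a i) =
      ENNReal.ofReal ((√(2 * π))⁻¹ ^ n * exp (-(∑ i, (a i - m i) ^ 2) / 2)) := by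
  simp only [gaussianPDF]
  rw [← ENNReal.ofReal_prod_of_nonneg fun i _ => gaussianPDFReal_nonneg _ _ _]
  simp [gaussianPDFReal, Finset.prod_mul_distrib, ← Real.exp_sum, ← Finset.sum_div]

theorem measurable_prod_gaussianPDF {n : ℕ} (m : Fin n → ℝ) :
    Measurable fun a : Fin n → ℝ => ∏ i, gaussianPDF (m i) 1 (a i) :=
  Finset.measurable_prod _ fun i _ => (measurable_gaussianPDF _ _).comp (measurable_pi_apply i)

theorem pi_gaussianReal_eq_withDensity {n : ℕ} (m : Fin n → ℝ) :
    Measure.pi (fun i => gaussianReal (m i) 1) =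
      volume.withDensity fun a => ∏ i, gaussianPDF (m i) 1 (a i) := by
  have h : ∀ i, gaussianReal (m i) 1 = volume.withDensity (gaussianPDF (m i) 1) := fun i =>
    gaussianReal_of_var_ne_zero _ one_ne_zero
  have : ∀ i, SigmaFinite ((volume : Measure ℝ).withDensity (gaussianPDF (m i) 1)) := fun i => by
    rw [← h]; infer_instance
  simp only [h]
  exact pi_withDensity_fin _ _ fun i => measurable_gaussianPDF _ _

theorem lintegral_affine {a b : ℝ} (hb : b ≠ 0) (F : ℝ → ℝ≥0∞) :
    ∫⁻ x, F x = ENNReal.ofReal |b| * ∫⁻ s, F (a + s * b) := by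
  have h := lintegral_image_eq_lintegral_abs_deriv_mul (s := univ) (f := fun s => a + s * b)
    (f' := fun _ => b) MeasurableSet.univ
    (fun x _ => by
      simpa using (((hasDerivAt_id x).mul_const b).const_add a).hasDerivWithinAt (s := univ))
    (fun x _ y _ hxy => by simpa [hb] using hxy) F
  have himg : (fun s => a + s * b) '' univ = univ :=
    eq_univ_of_forall fun x => ⟨(x - a) / b, trivial, by field_simp; ring⟩
  rw [himg, setLIntegral_univ, setLIntegral_univ] at h
  rw [h, lintegral_const_mul' _ _ ENNReal.ofReal_ne_top]

/-- The point of the hyperplane orthogonal to `c` whose coordinates other than `j` are `y`. -/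
noncomputable def hyperplaneLift {n : ℕ} (j : Fin (n + 1)) (c : Fin (n + 1) → ℝ) (y : Fin n → ℝ) :
    Fin (n + 1) → ℝ :=
  j.insertNth (α := fun _ => ℝ) (-(∑ k, y k * c (j.succAbove k)) / c j) y

theorem sum_hyperplaneLift_mul {n : ℕ} {j : Fin (n + 1)} {c : Fin (n + 1) → ℝ} (hcj : c j ≠ 0)
    (y : Fin n → ℝ) : ∑ i, hyperplaneLift j c y i * c i = 0 := by
  rw [Fin.sum_univ_succAbove _ j]
  simp [hyperplaneLift, hcj]

theorem hyperplaneLift_add_smul {n : ℕ} {j : Fin (n + 1)} {c : Fin (n + 1) → ℝ}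
    (hc : ∑ i, c i ^ 2 = 1) (hcj : c j ≠ 0) (y : Fin n → ℝ) (s : ℝ) :
    j.insertNth (α := fun _ => ℝ)
      (-(∑ k, (y k + s * c (j.succAbove k)) * c (j.succAbove k)) / c j + s * (c j)⁻¹)
      (y + fun k => s * c (j.succAbove k)) = fun i => hyperplaneLift j c y i + s * c i := by
  rw [Fin.sum_univ_succAbove _ j] at hc
  have hs : ∑ k, (y k + s * c (j.succAbove k)) * c (j.succAbove k) =
      ∑ k, y k * c (j.succAbove k) + s * (1 - c j ^ 2) := by
    rw [← hc, add_sub_cancel_left, Finset.mul_sum, ← Finset.sum_add_distrib]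
    exact Finset.sum_congr rfl fun k _ => by ring
  ext i
  rcases Fin.eq_self_or_eq_succAbove j i with rfl | ⟨k, rfl⟩
  · simp only [hyperplaneLift, Fin.insertNth_apply_same, hs]
    field_simp
    ring
  · simp [hyperplaneLift]

theorem lintegral_hyperplaneLift {n : ℕ} {j : Fin (n + 1)} {c : Fin (n + 1) → ℝ}
    (hc : ∑ i, c i ^ 2 = 1) (hcj : c j ≠ 0) {K : (Fin (n + 1) → ℝ) → ℝ≥0∞} (hK : Measurable K) :
    ENNReal.ofReal |c j| * ∫⁻ a, K a =
      ∫⁻ s : ℝ, ∫⁻ y, K fun i => hyperplaneLift j c y i + s * c i := by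
  have hL : ∀ y : Fin n → ℝ, ∫⁻ x, K (j.insertNth (α := fun _ => ℝ) x y) =
      ENNReal.ofReal |(c j)⁻¹| * ∫⁻ s : ℝ, K (j.insertNth (α := fun _ => ℝ)
        (-(∑ k, y k * c (j.succAbove k)) / c j + s * (c j)⁻¹) y) := fun y =>
    lintegral_affine (inv_ne_zero hcj) _
  have hm : Measurable fun p : (Fin n → ℝ) × ℝ => K (j.insertNth (α := fun _ => ℝ)
      (-(∑ k, p.1 k * c (j.succAbove k)) / c j + p.2 * (c j)⁻¹) p.1) :=
    hK.comp ((measurable_insertNth j).comp (by fun_prop : Measurable fun p : (Fin n → ℝ) × ℝ =>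
      (-(∑ k, p.1 k * c (j.succAbove k)) / c j + p.2 * (c j)⁻¹, p.1)))
  rw [volume_pi, lintegral_pi_insertNth _ j hK,
    lintegral_prod_symm' _ (by exact hK.comp (measurable_insertNth j))]
  simp only [hL]
  rw [lintegral_const_mul' _ _ ENNReal.ofReal_ne_top, ← mul_assoc,
    ← ENNReal.ofReal_mul (abs_nonneg _), ← abs_mul, mul_inv_cancel₀ hcj, abs_one,
    ENNReal.ofReal_one, one_mul, lintegral_lintegral_swap hm.aemeasurable]
  refine lintegral_congr fun s => ?_
  rw [← volume_pi, ← lintegral_add_right_eq_self _ fun k => s * c (j.succAbove k)]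
  refine lintegral_congr fun y => ?_
  rw [← hyperplaneLift_add_smul hc hcj]
  rfl

theorem lintegral_hyperplane_abs_mul_gaussianPDF {n : ℕ} {j : Fin (n + 1)} {c : Fin (n + 1) → ℝ}
    (u m : Fin (n + 1) → ℝ) (hc : ∑ i, c i ^ 2 = 1) (hcj : c j ≠ 0) (hu : ∑ i, u i ^ 2 = 1)
    (hcu : ∑ i, c i * u i = 0) :
    ∫⁻ y, ENNReal.ofReal |∑ i, hyperplaneLift j c y i * u i| *
        ∏ i, gaussianPDF (m i) 1 (hyperplaneLift j c y i) =
      ENNReal.ofReal |c j| * ENNReal.ofReal (1 / π * exp (-(∑ i, m i * c i) ^ 2 / 2) *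
        (exp (-(∑ i, m i * u i) ^ 2 / 2) +
          √(π / 2) * (∑ i, m i * u i) * erf ((∑ i, m i * u i) / √2))) := by
  set M := ∑ i, m i * c i with hM
  set m' : Fin (n + 1) → ℝ := fun i => m i - M * c i with hm'
  set C : ℝ := (√(2 * π))⁻¹ * exp (-M ^ 2 / 2) with hC
  have hC0 : 0 ≤ C := by positivity
  have hmu : ∑ i, m' i * u i = ∑ i, m i * u i := by
    simp only [hm', sub_mul, Finset.sum_sub_distrib, mul_assoc, ← Finset.mul_sum, hcu]
    ring
  have hE := lintegral_abs_sum_mul_pi_gaussianReal m' u hu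
  rw [hmu] at hE
  rw [pi_gaussianReal_eq_withDensity, lintegral_withDensity_eq_lintegral_mul _
    (measurable_prod_gaussianPDF m') (by fun_prop)] at hE
  have hK := lintegral_hyperplaneLift hc hcj ((measurable_prod_gaussianPDF m').mul
    (by fun_prop : Measurable fun a : Fin (n + 1) → ℝ => ENNReal.ofReal |∑ i, a i * u i|))
  rw [hE] at hK
  have hfac : ∀ (s : ℝ) (y : Fin n → ℝ),
      ENNReal.ofReal C * ∏ i, gaussianPDF (m' i) 1 (hyperplaneLift j c y i + s * c i) =
        gaussianPDF 0 1 s * ∏ i, gaussianPDF (m i) 1 (hyperplaneLift j c y i) := by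
    intro s y
    have hL := sum_hyperplaneLift_mul hcj y
    set b := hyperplaneLift j c y
    have hsq : ∑ i, (b i + s * c i - m' i) ^ 2 = ∑ i, (b i - m i) ^ 2 + s ^ 2 - M ^ 2 := by
      have : ∀ i, (b i + s * c i - m' i) ^ 2 = (b i - m i) ^ 2 + 2 * (s + M) * (b i * c i)
          - 2 * (s + M) * (m i * c i) + (s + M) ^ 2 * c i ^ 2 := fun i => by
        simp only [hm']; ring
      simp only [this, Finset.sum_add_distrib, Finset.sum_sub_distrib, ← Finset.mul_sum, hL, hc,
        ← hM]
      ring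
    rw [prod_gaussianPDF_one, prod_gaussianPDF_one, hsq, gaussianPDF,
      ← ENNReal.ofReal_mul hC0, ← ENNReal.ofReal_mul (gaussianPDFReal_nonneg _ _ _)]
    congr 1
    have hexp : exp (-M ^ 2 / 2) * exp (-(∑ i, (b i - m i) ^ 2 + s ^ 2 - M ^ 2) / 2) =
        exp (-s ^ 2 / 2) * exp (-(∑ i, (b i - m i) ^ 2) / 2) := by
      rw [← exp_add, ← exp_add]
      ring_nf
    simp only [hC, gaussianPDFReal, NNReal.coe_one, mul_one, sub_zero]
    linear_combination (√(2 * π))⁻¹ * (√(2 * π))⁻¹ ^ (n + 1) * hexp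
  have habs : ∀ (s : ℝ) (y : Fin n → ℝ), ∑ i, (hyperplaneLift j c y i + s * c i) * u i =
      ∑ i, hyperplaneLift j c y i * u i := fun s y => by
    simp only [add_mul, Finset.sum_add_distrib, mul_assoc, ← Finset.mul_sum, hcu]
    ring
  have hlhs : ENNReal.ofReal C * ∫⁻ (s : ℝ) (y : Fin n → ℝ),
      ((fun a : Fin (n + 1) → ℝ => ∏ i, gaussianPDF (m' i) 1 (a i)) *
        fun a : Fin (n + 1) → ℝ => ENNReal.ofReal |∑ i, a i * u i|)
          (fun i => hyperplaneLift j c y i + s * c i) =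
      ∫⁻ y, ENNReal.ofReal |∑ i, hyperplaneLift j c y i * u i| *
        ∏ i, gaussianPDF (m i) 1 (hyperplaneLift j c y i) := by
    rw [← lintegral_const_mul' _ _ ENNReal.ofReal_ne_top]
    simp only [Pi.mul_apply, habs]
    have : ∀ s : ℝ, ENNReal.ofReal C * ∫⁻ y : Fin n → ℝ,
        (∏ i, gaussianPDF (m' i) 1 (hyperplaneLift j c y i + s * c i)) *
          ENNReal.ofReal |∑ i, hyperplaneLift j c y i * u i| =
        gaussianPDF 0 1 s * ∫⁻ y, ENNReal.ofReal |∑ i, hyperplaneLift j c y i * u i| *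
          ∏ i, gaussianPDF (m i) 1 (hyperplaneLift j c y i) := fun s => by
      rw [← lintegral_const_mul' _ _ ENNReal.ofReal_ne_top,
        ← lintegral_const_mul' _ _ gaussianPDF_ne_top]
      refine lintegral_congr fun y => ?_
      rw [← mul_assoc, hfac]
      ring
    simp only [this]
    rw [lintegral_mul_const _ (measurable_gaussianPDF _ _),
      lintegral_gaussianPDF_eq_one _ one_ne_zero, one_mul]
  rw [← hlhs, ← hK, mul_left_comm, ← ENNReal.ofReal_mul hC0]
  congr 2
  have h2π : √(2 * π) * √(2 * π) = 2 * π := Real.mul_self_sqrt (by positivity)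
  have h : (√(2 * π))⁻¹ * (2 / √(2 * π)) = 1 / π := by
    rw [inv_mul_eq_div, div_div, h2π]
    field_simp
  rw [hC, ← h]
  ring

theorem hasFDerivAt_hyperplaneLift_coord {n : ℕ} {j : Fin (n + 1)} {c c' : ℝ → Fin (n + 1) → ℝ}
    (hc' : ∀ t i, HasDerivAt (fun t => c t i) (c' t i) t) {z : Fin (n + 1) → ℝ}
    (hz : c (z j) j ≠ 0) :
    ∃ g' : (Fin (n + 1) → ℝ) →L[ℝ] ℝ,
      HasFDerivAt (fun z : Fin (n + 1) → ℝ =>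
        -(∑ k, z (j.succAbove k) * c (z j) (j.succAbove k)) / c (z j) j) g' z ∧
      g' (Pi.single j 1) = -(∑ i, hyperplaneLift j (c (z j)) (fun k => z (j.succAbove k)) i *
        c' (z j) i) / c (z j) j := by
  have hproj : ∀ i, HasFDerivAt (fun z : Fin (n + 1) → ℝ => z i)
      (ContinuousLinearMap.proj (R := ℝ) (φ := fun _ : Fin (n + 1) => ℝ) i) z := fun i =>
    hasFDerivAt_apply i z
  have hci : ∀ i, HasFDerivAt (fun z : Fin (n + 1) → ℝ => c (z j) i)
      (c' (z j) i • ContinuousLinearMap.proj (R := ℝ) (φ := fun _ : Fin (n + 1) => ℝ) j) z :=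
    fun i => HasDerivAt.comp_hasFDerivAt (h₂ := fun t => c t i) z (hc' (z j) i) (hproj j)
  have hN := (HasFDerivAt.fun_sum (u := Finset.univ) fun k _ =>
    (hproj (j.succAbove k)).mul (hci (j.succAbove k))).fun_neg
  have hq := hN.fun_mul ((hasDerivAt_inv hz).comp_hasFDerivAt z (hci j))
  refine ⟨_, hq, ?_⟩
  rw [Fin.sum_univ_succAbove _ j]
  simp [hyperplaneLift]
  field_simp
  ring

theorem encard_hyperplaneLift_fiber {n : ℕ} {j : Fin (n + 1)} {c : ℝ → Fin (n + 1) → ℝ}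
    {S : Set ℝ} (hS : ∀ t ∈ S, c t j ≠ 0) (a : Fin (n + 1) → ℝ) :
    ({z : Fin (n + 1) → ℝ | z j ∈ S} ∩
      (fun z => hyperplaneLift j (c (z j)) (fun k => z (j.succAbove k))) ⁻¹' {a}).encard =
    {t | t ∈ S ∧ ∑ i, a i * c t i = 0}.encard := by
  have hinj : InjOn (fun t : ℝ => j.insertNth (α := fun _ => ℝ) t fun k => a (j.succAbove k))
      {t | t ∈ S ∧ ∑ i, a i * c t i = 0} := fun t _ t' _ h => by
    simpa using congrFun h j
  rw [← hinj.encard_image]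
  congr 1
  ext z
  simp only [mem_inter_iff, mem_ofPred_eq, mem_preimage, mem_singleton_iff, mem_image]
  constructor
  · rintro ⟨hz, rfl⟩
    refine ⟨z j, ⟨hz, sum_hyperplaneLift_mul (hS _ hz) _⟩, ?_⟩
    simp only [hyperplaneLift, Fin.insertNth_apply_succAbove]
    exact Fin.insertNth_self_removeNth j z
  · rintro ⟨t, ⟨ht, h0⟩, rfl⟩
    simp only [Fin.insertNth_apply_same, Fin.insertNth_apply_succAbove]
    refine ⟨ht, ?_⟩
    have hcj := hS t ht
    rw [Fin.sum_univ_succAbove _ j] at h0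
    ext i
    rcases Fin.eq_self_or_eq_succAbove j i with rfl | ⟨k, rfl⟩
    · simp only [hyperplaneLift, Fin.insertNth_apply_same]
      field_simp
      linarith
    · simp [hyperplaneLift]

theorem lintegral_encard_zeros_mul {n : ℕ} {j : Fin (n + 1)} {c c' : ℝ → Fin (n + 1) → ℝ}
    (hc' : ∀ t i, HasDerivAt (fun t => c t i) (c' t i) t)
    {S : Set ℝ} (hSm : MeasurableSet S) (hS : ∀ t ∈ S, c t j ≠ 0)
    {w : (Fin (n + 1) → ℝ) → ℝ≥0∞} (hw : Measurable w) :
    AEMeasurable (fun a => ({t | t ∈ S ∧ ∑ i, a i * c t i = 0}.encard : ℝ≥0∞) * w a) ∧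
    ∫⁻ a, ({t | t ∈ S ∧ ∑ i, a i * c t i = 0}.encard : ℝ≥0∞) * w a =
      ∫⁻ t in S, ∫⁻ y, ENNReal.ofReal |(∑ i, hyperplaneLift j (c t) y i * c' t i) / c t j| *
        w (hyperplaneLift j (c t) y) := by
  have hcm : ∀ i, Measurable fun t => c t i := fun i =>
    (continuous_iff_continuousAt.2 fun t => (hc' t i).continuousAt).measurable
  have hc'm : ∀ i, Measurable fun t => c' t i := fun i => by
    have : (fun t => c' t i) = deriv fun t => c t i := funext fun t => (hc' t i).deriv.symm
    rw [this]
    exact measurable_deriv _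
  set L : ℝ × (Fin n → ℝ) → Fin (n + 1) → ℝ := fun p => hyperplaneLift j (c p.1) p.2 with hL
  have hLm : Measurable L := (measurable_insertNth j).comp (by fun_prop : Measurable
    fun p : ℝ × (Fin n → ℝ) => (-(∑ k, p.2 k * c p.1 (j.succAbove k)) / c p.1 j, p.2))
  set D : ℝ × (Fin n → ℝ) → ℝ := fun p => (∑ i, L p i * c' p.1 i) / c p.1 j with hD
  have hDm : Measurable D := by fun_prop
  set e : (Fin (n + 1) → ℝ) → ℝ × (Fin n → ℝ) := fun z => (z j, fun k => z (j.succAbove k)) with he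
  have hem : Measurable e := by fun_prop
  set g : (Fin (n + 1) → ℝ) → ℝ := fun z =>
    -(∑ k, z (j.succAbove k) * c (z j) (j.succAbove k)) / c (z j) j with hg
  set P := ContinuousLinearMap.proj (R := ℝ) (φ := fun _ : Fin (n + 1) => ℝ) j with hP
  set Φ' : (Fin (n + 1) → ℝ) → (Fin (n + 1) → ℝ) →L[ℝ] (Fin (n + 1) → ℝ) := fun z =>
    ContinuousLinearMap.id ℝ _ + (fderiv ℝ g z - P).smulRight (Pi.single j 1) with hΦ'
  set s : Set (Fin (n + 1) → ℝ) := {z | z j ∈ S} with hs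
  have hsm : MeasurableSet s := measurable_pi_apply j hSm
  have hdet : ∀ z ∈ s, (Φ' z).det = -D (e z) := by
    intro z hz
    obtain ⟨g', hg', hgj⟩ := hasFDerivAt_hyperplaneLift_coord hc' (hS _ hz)
    have : ((Φ' z : (Fin (n + 1) → ℝ) →L[ℝ] (Fin (n + 1) → ℝ)) :
        (Fin (n + 1) → ℝ) →ₗ[ℝ] (Fin (n + 1) → ℝ)) =
        LinearMap.transvection ((g' - P : (Fin (n + 1) → ℝ) →L[ℝ] ℝ) :
          Module.Dual ℝ (Fin (n + 1) → ℝ)) (Pi.single j 1) := by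
      rw [hΦ', ← hg'.fderiv]
      rfl
    rw [ContinuousLinearMap.det, this, LinearMap.transvection.det]
    change 1 + (g' (Pi.single j 1) - (Pi.single j 1 : Fin (n + 1) → ℝ) j) = _
    rw [hgj, Pi.single_eq_same, add_sub_cancel, neg_div]
  have hΦ : ∀ z ∈ s, HasFDerivWithinAt (fun z => L (e z)) (Φ' z) s z := by
    intro z hz
    obtain ⟨g', hg', -⟩ := hasFDerivAt_hyperplaneLift_coord hc' (hS _ hz)
    have h : HasFDerivAt (fun z => z + (g z - P z) • (Pi.single j 1 : Fin (n + 1) → ℝ)) (Φ' z) z :=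
      (hasFDerivAt_id z).add
        ((hg'.differentiableAt.hasFDerivAt.sub P.hasFDerivAt).smul_const _)
    refine (h.congr_of_eventuallyEq (Filter.Eventually.of_forall fun z => ?_)).hasFDerivWithinAt
    ext i
    rcases Fin.eq_self_or_eq_succAbove j i with rfl | ⟨k, rfl⟩
    · simp [hL, he, hyperplaneLift, hg, hP]
    · simp [hL, he, hyperplaneLift]
  have hdm : MeasurableSet {z | z ∈ s ∧ (Φ' z).det ≠ 0} := by
    have : {z | z ∈ s ∧ (Φ' z).det ≠ 0} = s ∩ {z | D (e z) ≠ 0} := by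
      ext z
      simp only [mem_ofPred_eq, mem_inter_iff]
      exact and_congr_right fun hz => by rw [hdet z hz, neg_ne_zero]
    rw [this]
    exact hsm.inter ((hDm.comp hem) (measurableSet_singleton 0).compl)
  have key := lintegral_encard_fiber_mul volume hsm hΦ hdm hw
  have hfib : ∀ a, (s ∩ (fun z => L (e z)) ⁻¹' {a}).encard =
      {t | t ∈ S ∧ ∑ i, a i * c t i = 0}.encard := encard_hyperplaneLift_fiber hS
  simp only [hfib] at key
  refine ⟨key.1, key.2.trans ?_⟩
  have hFm : Measurable fun p => ENNReal.ofReal |D p| * w (L p) := by fun_prop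
  have hIm : Measurable (s.indicator fun z => ENNReal.ofReal |D (e z)| * w (L (e z))) :=
    (hFm.comp hem).indicator hsm
  rw [setLIntegral_congr_fun (g := fun z => ENNReal.ofReal |D (e z)| * w (L (e z))) hsm
    fun z hz => by simp only [hdet z hz, abs_neg], ← lintegral_indicator hsm, volume_pi,
    lintegral_pi_insertNth _ j hIm,
    lintegral_prod _ (by exact (hIm.comp (measurable_insertNth j)).aemeasurable),
    ← lintegral_indicator hSm]
  refine lintegral_congr fun t => ?_
  by_cases ht : t ∈ S
  · simp only [indicator_of_mem ht]
    refine lintegral_congr fun y => ?_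
    rw [indicator_of_mem (by simpa [hs] using ht)]
    simp [hD, hL, he]
  · simp [ht, hs]

/-- The density of zeros of `∑ i, a i * c t i` at a point where the unit vector `c` has velocity
`c'` of norm `N` and the `a i` are independent normal variables of means `m i` and variance one. -/
noncomputable def zeroDensity {n : ℕ} (m c c' : Fin n → ℝ) (N : ℝ) : ℝ :=
  1 / π * N * exp (-(∑ i, m i * c i) ^ 2 / 2) *
    (exp (-((∑ i, m i * c' i) / N) ^ 2 / 2) +
      √(π / 2) * ((∑ i, m i * c' i) / N) * erf (((∑ i, m i * c' i) / N) / √2))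

theorem lintegral_hyperplane_velocity_mul_gaussianPDF {n : ℕ} {j : Fin (n + 1)}
    {c c' : Fin (n + 1) → ℝ} {N : ℝ} (m : Fin (n + 1) → ℝ) (hc : ∑ i, c i ^ 2 = 1) (hcj : c j ≠ 0)
    (hN : 0 < N) (hc' : ∑ i, c' i ^ 2 = N ^ 2) (hcc' : ∑ i, c i * c' i = 0) :
    ∫⁻ y, ENNReal.ofReal |(∑ i, hyperplaneLift j c y i * c' i) / c j| *
        ∏ i, gaussianPDF (m i) 1 (hyperplaneLift j c y i) =
      ENNReal.ofReal (zeroDensity m c c' N) := by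
  have hdiv : ∀ b : Fin (n + 1) → ℝ, ∑ i, b i * (c' i / N) = (∑ i, b i * c' i) / N := fun b => by
    rw [Finset.sum_div]
    exact Finset.sum_congr rfl fun i _ => by ring
  have hu : ∑ i, (c' i / N) ^ 2 = 1 := by
    simp only [div_pow, ← Finset.sum_div, hc']
    exact div_self (by positivity)
  have h := lintegral_hyperplane_abs_mul_gaussianPDF (fun i => c' i / N) m hc hcj hu
    (by rw [hdiv, hcc', zero_div])
  simp only [hdiv] at h
  have hfac : ∀ x : ℝ, ENNReal.ofReal |x / c j| =
      ENNReal.ofReal (N / |c j|) * ENNReal.ofReal |x / N| := fun x => by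
    rw [← ENNReal.ofReal_mul (by positivity), abs_div, abs_div, abs_of_pos hN]
    congr 1
    field_simp
  simp only [hfac, mul_assoc]
  rw [lintegral_const_mul' _ _ ENNReal.ofReal_ne_top, h, ← mul_assoc,
    ← ENNReal.ofReal_mul (by positivity), div_mul_cancel₀ _ (abs_ne_zero.2 hcj),
    ← ENNReal.ofReal_mul hN.le, zeroDensity]
  congr 1
  ring

theorem encard_iUnion_inter_eq_sum {n : ℕ} {U : Fin n → Set ℝ} (hU : ∀ j, MeasurableSet (U j))
    (hdisj : Pairwise (Function.onFun Disjoint U)) {Z : Set ℝ} (hZ : MeasurableSet Z) :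
    (((⋃ j, U j) ∩ Z).encard : ℝ≥0∞) = ∑ j, ((U j ∩ Z).encard : ℝ≥0∞) := by
  simp only [← Measure.count_apply ((MeasurableSet.iUnion hU).inter hZ),
    ← Measure.count_apply ((hU _).inter hZ)]
  rw [iUnion_inter, measure_iUnion (fun i j hij => (hdisj hij).mono inter_subset_left
    inter_subset_left) fun j => (hU j).inter hZ, tsum_fintype]

theorem lintegral_encard_zeros_pi_gaussianReal {n : ℕ} {c c' : ℝ → Fin (n + 1) → ℝ} {N : ℝ → ℝ}
    (m : Fin (n + 1) → ℝ) (hder : ∀ t i, HasDerivAt (fun t => c t i) (c' t i) t)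
    (hc : ∀ t, ∑ i, c t i ^ 2 = 1) (hN : ∀ t, 0 < N t) (hc' : ∀ t, ∑ i, c' t i ^ 2 = N t ^ 2)
    {I : Set ℝ} (hI : MeasurableSet I) :
    ∫⁻ a, ({t | t ∈ I ∧ ∑ i, a i * c t i = 0}.encard : ℝ≥0∞)
        ∂(Measure.pi fun i => gaussianReal (m i) 1) =
      ∫⁻ t in I, ENNReal.ofReal (zeroDensity m (c t) (c' t) (N t)) := by
  have hcm : ∀ i, Measurable fun t => c t i := fun i =>
    (continuous_iff_continuousAt.2 fun t => (hder t i).continuousAt).measurable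
  have hcc' : ∀ t, ∑ i, c t i * c' t i = 0 := fun t => by
    have h := HasDerivAt.fun_sum (u := Finset.univ) fun i _ => (hder t i).fun_pow 2
    simp only [hc] at h
    have h0 := h.unique (hasDerivAt_const t (1 : ℝ))
    simp only [Nat.cast_ofNat, Nat.add_one_sub_one, pow_one, mul_assoc, ← Finset.mul_sum] at h0
    simpa using h0
  set U : Fin (n + 1) → Set ℝ := fun j => I ∩ {t | c t j ≠ 0 ∧ ∀ i < j, c t i = 0} with hUdef
  have hU : ∀ j, MeasurableSet (U j) := fun j => by
    have : {t | ∀ i < j, c t i = 0} = ⋂ i, ⋂ _ : i < j, {t | c t i = 0} := by ext; simp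
    have hm : MeasurableSet {t | ∀ i < j, c t i = 0} := this ▸
      MeasurableSet.iInter fun i => MeasurableSet.iInter fun _ => hcm i (measurableSet_singleton 0)
    exact hI.inter (((hcm j) (measurableSet_singleton 0).compl).inter hm)
  have hdisj : Pairwise (Function.onFun Disjoint U) := fun i j hij => by
    refine disjoint_left.2 fun t hi hj => ?_
    rcases hij.lt_or_gt with h | h
    · exact hi.2.1 (hj.2.2 i h)
    · exact hj.2.1 (hi.2.2 j h)
  have hIU : ⋃ j, U j = I := by
    refine subset_antisymm (iUnion_subset fun j => inter_subset_left) fun t ht => ?_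
    have hex : ∃ j, c t j ≠ 0 := by
      by_contra! h
      simpa [h] using hc t
    obtain ⟨j, hj, hmin⟩ := WellFounded.has_min (wellFounded_lt (α := Fin (n + 1)))
      {j | c t j ≠ 0} hex
    exact mem_iUnion.2 ⟨j, ht, hj, fun i hi => by_contra fun h => hmin i h hi⟩
  have hZ : ∀ a : Fin (n + 1) → ℝ, MeasurableSet {t | ∑ i, a i * c t i = 0} := fun a =>
    measurableSet_eq_fun (by fun_prop) measurable_const
  have hw := measurable_prod_gaussianPDF m
  have hkey := fun j => lintegral_encard_zeros_mul hder (hU j) (fun t ht => ht.2.1) hw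
  rw [pi_gaussianReal_eq_withDensity, lintegral_withDensity_eq_lintegral_mul_non_measurable _ hw
    (.of_forall fun a => ENNReal.prod_lt_top fun i _ => gaussianPDF_lt_top)]
  have hsplit : ∀ a : Fin (n + 1) → ℝ, ({t | t ∈ I ∧ ∑ i, a i * c t i = 0}.encard : ℝ≥0∞) =
      ∑ j, ({t | t ∈ U j ∧ ∑ i, a i * c t i = 0}.encard : ℝ≥0∞) := fun a => by
    rw [← hIU]
    exact encard_iUnion_inter_eq_sum hU hdisj (hZ a)
  simp only [Pi.mul_apply, hsplit, mul_comm (∏ i, _), Finset.sum_mul]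
  rw [lintegral_finsetSum' _ fun j _ => (hkey j).1]
  conv_rhs => rw [← hIU, lintegral_iUnion hU hdisj, tsum_fintype]
  refine Finset.sum_congr rfl fun j _ => (hkey j).2.trans ?_
  exact setLIntegral_congr_fun (hU j) fun t ht =>
    lintegral_hyperplane_velocity_mul_gaussianPDF m (hc t) ht.2.1 (hN t) (hc' t) (hcc' t)

/-- Theorem 5.2: for coefficients which are independent normals with mean vector `m`
and identity covariance, the density of real zeros of `Σ aᵢ fᵢ(t) = 0` is
`(1/π) ‖γ'(t)‖ e^{-m₀(t)²/2} (e^{-m₁(t)²/2} + √(π/2) m₁(t) erf(m₁(t)/√2))`,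
where `γ = v/‖v‖`, `m₀(t) = m·γ(t)` and `m₁(t) = m·γ'(t)/‖γ'(t)‖`. -/
theorem noncentral_normal_zero_density (n : ℕ) (f : Fin (n + 1) → ℝ → ℝ)
    (hf : ∀ i, Differentiable ℝ (f i))
    (v : ℝ → EuclideanSpace ℝ (Fin (n + 1)))
    (hv : ∀ t i, v t i = f i t) (hv0 : ∀ t, v t ≠ 0)
    (γ : ℝ → EuclideanSpace ℝ (Fin (n + 1)))
    (hγ : ∀ t, γ t = ‖v t‖⁻¹ • v t) (hγ' : ∀ t, deriv γ t ≠ 0)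
    (m : Fin (n + 1) → ℝ) (m₀ m₁ : ℝ → ℝ)
    (hm₀ : ∀ t, m₀ t = ∑ i, m i * γ t i)
    (hm₁ : ∀ t, m₁ t = (∑ i, m i * deriv γ t i) / ‖deriv γ t‖)
    (I : Set ℝ) (hI : MeasurableSet I) :
    ∫⁻ a : Fin (n + 1) → ℝ,
        ({t : ℝ | t ∈ I ∧ ∑ i : Fin (n + 1), a i * f i t = 0}.encard : ℝ≥0∞)
        ∂(Measure.pi fun i => gaussianReal (m i) 1)
      = ∫⁻ t in I, ENNReal.ofReal
          ((1 / π) * ‖deriv γ t‖ * Real.exp (-(m₀ t) ^ 2 / 2) *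
            (Real.exp (-(m₁ t) ^ 2 / 2)
              + Real.sqrt (π / 2) * m₁ t * erf (m₁ t / Real.sqrt 2))) := by
  have hvd : Differentiable ℝ v := differentiable_euclidean.2 fun i => by simpa only [hv] using hf i
  have hγd : Differentiable ℝ γ := by
    rw [funext hγ]
    exact ((hvd.norm ℝ hv0).inv fun t => norm_ne_zero_iff.2 (hv0 t)).smul hvd
  have hder : ∀ t i, HasDerivAt (fun t => γ t i) (deriv γ t i) t := fun t i =>
    ((EuclideanSpace.proj (𝕜 := ℝ) i).hasFDerivAt.comp_hasDerivAt t (hγd t).hasDerivAt)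
  have hnorm : ∀ t, ∑ i, γ t i ^ 2 = 1 := fun t => by
    rw [← EuclideanSpace.real_norm_sq_eq, hγ, norm_smul, norm_inv, norm_norm,
      inv_mul_cancel₀ (norm_ne_zero_iff.2 (hv0 t)), one_pow]
  have hzero : ∀ (a : Fin (n + 1) → ℝ) t, ∑ i, a i * f i t = 0 ↔ ∑ i, a i * γ t i = 0 := by
    intro a t
    have : ∑ i, a i * γ t i = ‖v t‖⁻¹ * ∑ i, a i * f i t := by
      rw [Finset.mul_sum]
      exact Finset.sum_congr rfl fun i _ => by simp [hγ, hv, mul_left_comm]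
    rw [this, mul_eq_zero, or_iff_right (inv_ne_zero (norm_ne_zero_iff.2 (hv0 t)))]
  simp only [hzero, hm₀, hm₁]
  exact lintegral_encard_zeros_pi_gaussianReal m hder hnorm (fun t => norm_pos_iff.2 (hγ' t))
    (fun t => (EuclideanSpace.real_norm_sq_eq _).symm) hI
end

section
/- Let a₀, a₁, a₂ be independent standard normal real random variables and let m ∈ ℝ. Then the expected number of real zeros of the random quadratic polynomial p(t) = (a₀ + m) + a₁·√2·t + (a₂ + m)·t² equals √2 · e^(−m²/2), and for every measurable I ⊆ ℝ the expected number of zeros in I equals ∫_I (√2/(π(1+t²)))·e^(−m²/2) dt. (Example 1, Section 5.3.) -/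
open MeasureTheory ProbabilityTheory Real Set
open scoped ENNReal NNReal

/-- The cardinality of the fibres of an injective function is the indicator of its image. -/
theorem encard_fiber_of_injOn {α β : Type*} {f : α → β} {s : Set α} (hf : InjOn f s) (u : β) :
    ({t | t ∈ s ∧ f t = u}.encard : ℝ≥0∞) = (f '' s).indicator 1 u := by
  by_cases hu : u ∈ f '' s
  · obtain ⟨t, ht, rfl⟩ := hu
    have : {x | x ∈ s ∧ f x = f t} = {t} := by
      ext x
      simp only [mem_ofPred_eq, mem_singleton_iff]
      exact ⟨fun hx => hf hx.1 ht hx.2, by rintro rfl; exact ⟨ht, rfl⟩⟩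
    rw [this, indicator_of_mem (mem_image_of_mem f ht)]
    simp
  · have : {x | x ∈ s ∧ f x = u} = ∅ :=
      eq_empty_of_forall_notMem fun x hx => hu ⟨x, hx.1, hx.2⟩
    rw [this, indicator_of_notMem hu]
    simp

/-- Area formula for an injective differentiable function, in terms of fibre cardinalities. -/
theorem lintegral_encard_fiber_mul_of_injOn {f f' : ℝ → ℝ} {s : Set ℝ} (hs : MeasurableSet s)
    (hf' : ∀ x ∈ s, HasDerivWithinAt f (f' x) s x) (hf : InjOn f s) (g : ℝ → ℝ≥0∞) :
    ∫⁻ u, ({t | t ∈ s ∧ f t = u}.encard : ℝ≥0∞) * g u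
      = ∫⁻ t in s, ENNReal.ofReal |f' t| * g (f t) := by
  have himg : MeasurableSet (f '' s) :=
    hs.image_of_continuousOn_injOn (fun x hx => (hf' x hx).continuousWithinAt) hf
  rw [← lintegral_image_eq_lintegral_abs_deriv_mul hs hf' hf, ← lintegral_indicator himg]
  refine lintegral_congr fun u => ?_
  rw [encard_fiber_of_injOn hf]
  by_cases hu : u ∈ f '' s <;> simp [hu]

/-- Area formula for a quadratic function, in terms of the zeros of `(u + d) + b t + c t²`. -/
theorem lintegral_encard_quadratic_mul {I : Set ℝ} (hI : MeasurableSet I) (b c d : ℝ)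
    {g : ℝ → ℝ≥0∞} (hg : Measurable g) :
    ∫⁻ u, ({t | t ∈ I ∧ (u + d) + b * t + c * t ^ 2 = 0}.encard : ℝ≥0∞) * g u
      = ∫⁻ t in I, ENNReal.ofReal |b + 2 * c * t| * g (-(d + b * t + c * t ^ 2)) := by
  set f : ℝ → ℝ := fun t => -(d + b * t + c * t ^ 2) with hf
  set f' : ℝ → ℝ := fun t => -(b + 2 * c * t) with hf'
  have hderiv : ∀ t, HasDerivAt f (f' t) t := fun t => by
    have := (((hasDerivAt_id' t).const_mul b).const_add d).add ((hasDerivAt_pow 2 t).const_mul c)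
    exact this.neg.congr_deriv (by simp only [hf']; norm_num; ring)
  have hfc : Continuous f := by fun_prop
  have hf'm : Measurable f' := by fun_prop
  have hpos : MeasurableSet (I ∩ {t | 0 < f' t}) :=
    hI.inter (measurableSet_lt measurable_const hf'm)
  have hneg : MeasurableSet (I ∩ {t | f' t < 0}) :=
    hI.inter (measurableSet_lt hf'm measurable_const)
  have hzero : MeasurableSet (I ∩ {t | f' t = 0}) :=
    hI.inter (measurableSet_eq_fun hf'm measurable_const)
  have hsum : ∀ x y, f x = f y → x ≠ y → f' x + f' y = 0 := fun x y hxy hne => by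
    have : (x - y) * (f' x + f' y) = 0 := by
      simp only [hf, hf'] at hxy ⊢
      linear_combination 2 * hxy
    exact (mul_eq_zero.1 this).resolve_left (sub_ne_zero.2 hne)
  have hinjpos : InjOn f (I ∩ {t | 0 < f' t}) := fun x hx y hy hxy => by
    by_contra hne
    have := hsum x y hxy hne
    have h1 : 0 < f' x := hx.2
    have h2 : 0 < f' y := hy.2
    linarith
  have hinjneg : InjOn f (I ∩ {t | f' t < 0}) := fun x hx y hy hxy => by
    by_contra hne
    have := hsum x y hxy hne
    have h1 : f' x < 0 := hx.2
    have h2 : f' y < 0 := hy.2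
    linarith
  have hcrit : ∀ t, f' t = 0 → f t = f (-b / (2 * c)) := fun t ht => by
    simp only [hf, hf'] at ht ⊢
    rcases eq_or_ne c 0 with rfl | hc
    · have : b = 0 := by simpa using ht
      simp [this]
    · have : t = -b / (2 * c) := by
        field_simp
        linarith
      rw [← this]
  have hcount : (fun u => ({t | t ∈ I ∧ (u + d) + b * t + c * t ^ 2 = 0}.encard : ℝ≥0∞) * g u)
      =ᵐ[volume] fun u =>
        ({t | t ∈ I ∩ {t | 0 < f' t} ∧ f t = u}.encard : ℝ≥0∞) * g u +
          ({t | t ∈ I ∩ {t | f' t < 0} ∧ f t = u}.encard : ℝ≥0∞) * g u := by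
    have hne : ∀ᵐ u : ℝ, u ≠ f (-b / (2 * c)) := by
      simp [ae_iff]
    filter_upwards [hne] with u hu
    rw [← add_mul, ← ENat.toENNReal_add, ← encard_union_eq]
    · congr 3
      ext t
      have hiff : (u + d) + b * t + c * t ^ 2 = 0 ↔ f t = u := by
        simp only [hf]
        constructor <;> intro h <;> linarith
      simp only [mem_ofPred_eq, mem_union, mem_inter_iff, hiff]
      refine ⟨fun ⟨h1, h2⟩ => ?_, by tauto⟩
      have : f' t ≠ 0 := fun h => hu (h2.symm.trans (hcrit t h))
      rcases this.lt_or_gt with h | h <;> tauto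
    · rw [Set.disjoint_left]
      rintro t ⟨⟨-, h1⟩, -⟩ ⟨⟨-, h2⟩, -⟩
      exact lt_asymm (a := 0) (b := f' t) h1 h2
  have hmeas : Measurable fun u =>
      ({t | t ∈ I ∩ {t | 0 < f' t} ∧ f t = u}.encard : ℝ≥0∞) * g u := by
    simp only [encard_fiber_of_injOn hinjpos]
    exact (measurable_one.indicator
      (hpos.image_of_continuousOn_injOn hfc.continuousOn hinjpos)).mul hg
  rw [lintegral_congr_ae hcount, lintegral_add_left hmeas,
    lintegral_encard_fiber_mul_of_injOn hpos (fun t _ => (hderiv t).hasDerivWithinAt) hinjpos,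
    lintegral_encard_fiber_mul_of_injOn hneg (fun t _ => (hderiv t).hasDerivWithinAt) hinjneg,
    ← lintegral_indicator hpos, ← lintegral_indicator hneg, ← lintegral_indicator hI,
    ← lintegral_add_left (by measurability)]
  refine lintegral_congr fun t => ?_
  have habs : |f' t| = |b + 2 * c * t| := abs_neg _
  by_cases ht : t ∈ I
  · rcases lt_trichotomy (f' t) 0 with h | h | h
    · simp [indicator, ht, h, h.not_gt, habs, hf]
    · have h0 : |b + 2 * c * t| = 0 := by rw [← habs, h, abs_zero]
      simp [indicator, ht, h, h0]
    · simp [indicator, ht, h, h.not_gt, habs, hf]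
  · simp [indicator, ht]

theorem measurable_encard_quadratic {α : Type*} [MeasurableSpace α] {I : Set ℝ}
    (hI : MeasurableSet I) {u b c : α → ℝ} (hu : Measurable u) (hb : Measurable b)
    (hc : Measurable c) :
    Measurable fun x => ({t | t ∈ I ∧ u x + b x * t + c x * t ^ 2 = 0}.encard : ℝ≥0∞) := by
  classical
  have hind : Measurable (I.indicator (1 : ℝ → ℝ≥0∞)) := measurable_one.indicator hI
  have hsing : ∀ r : ℝ, ({t | t ∈ I ∧ t = r}.encard : ℝ≥0∞) = I.indicator 1 r := fun r => by
    simpa using encard_fiber_of_injOn (injOn_id I) r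
  set D : α → ℝ := fun x => discrim (c x) (b x) (u x) with hD
  have hDm : Measurable D := by
    simp only [hD, discrim]
    fun_prop
  have key : (fun x => ({t | t ∈ I ∧ u x + b x * t + c x * t ^ 2 = 0}.encard : ℝ≥0∞)) = fun x =>
      if c x = 0 then
        if b x = 0 then if u x = 0 then (I.encard : ℝ≥0∞) else 0
        else I.indicator 1 (-u x / b x)
      else if D x < 0 then 0
      else if D x = 0 then I.indicator 1 (-b x / (2 * c x))
      else I.indicator 1 ((-b x + √(D x)) / (2 * c x))
        + I.indicator 1 ((-b x - √(D x)) / (2 * c x)) := by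
    funext x
    split_ifs with h1 h2 h3 h4 h5
    · simp [h1, h2, h3]
    · simp [h1, h2, h3]
    · rw [← hsing]
      congr 3
      ext t
      simp only [h1, and_congr_right_iff]
      intro _
      rw [eq_div_iff h2]
      constructor <;> intro h <;> linarith
    · have : {t | t ∈ I ∧ u x + b x * t + c x * t ^ 2 = 0} = ∅ :=
        eq_empty_of_forall_notMem fun t ht => by
          have h0 : c x * (t * t) + b x * t + u x = 0 := by linear_combination ht.2
          have := discrim_eq_sq_of_quadratic_eq_zero h0
          simp only [hD] at h4
          nlinarith [sq_nonneg (2 * c x * t + b x)]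
      simp [this]
    · rw [← hsing]
      congr 3
      ext t
      simp only [and_congr_right_iff]
      intro _
      rw [← quadratic_eq_zero_iff_of_discrim_eq_zero h1 h5]
      constructor <;> intro h <;> linarith
    · have hpos : 0 < D x := lt_of_le_of_ne (not_lt.1 h4) (Ne.symm h5)
      have hs : D x = √(D x) * √(D x) := (Real.mul_self_sqrt hpos.le).symm
      rw [← hsing, ← hsing, ← ENat.toENNReal_add, ← encard_union_eq]
      · congr 2
        ext t
        simp only [mem_ofPred_eq, mem_union]
        rw [← and_or_left, ← quadratic_eq_zero_iff h1 hs]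
        refine and_congr_right fun _ => ?_
        constructor <;> intro h <;> linarith
      · rw [Set.disjoint_left]
        rintro t ⟨-, h6⟩ ⟨-, h7⟩
        have h8 := Real.sqrt_pos.2 hpos
        rw [h6] at h7
        field_simp at h7
        linarith
  rw [key]
  refine Measurable.ite (measurableSet_eq_fun hc measurable_const) ?_ ?_
  · refine Measurable.ite (measurableSet_eq_fun hb measurable_const) ?_ (hind.comp (by fun_prop))
    exact Measurable.ite (measurableSet_eq_fun hu measurable_const) measurable_const
      measurable_const
  · refine Measurable.ite (measurableSet_lt hDm measurable_const) measurable_const ?_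
    refine Measurable.ite (measurableSet_eq_fun hDm measurable_const) (hind.comp (by fun_prop)) ?_
    exact (hind.comp (by fun_prop)).add (hind.comp (by fun_prop))

theorem lintegral_comp_affine {a : ℝ} (ha : a ≠ 0) (b : ℝ) (g : ℝ → ℝ≥0∞) :
    ∫⁻ x, g (a * x + b) = ENNReal.ofReal |a|⁻¹ * ∫⁻ x, g x := by
  have hsurj : (fun x => a * x + b) '' univ = univ := by
    rw [image_univ]
    exact range_eq_univ.2 fun y => ⟨(y - b) / a, by field_simp; ring⟩
  have h := lintegral_image_eq_lintegral_abs_deriv_mul (f := fun x => a * x + b) (f' := fun _ => a)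
    MeasurableSet.univ (fun x _ => by
      simpa only [mul_one] using
        (((hasDerivAt_id' x).const_mul a).add_const b).hasDerivWithinAt (s := univ))
    (fun x _ y _ hxy => by simpa [ha] using hxy) g
  rw [hsurj, setLIntegral_univ, setLIntegral_univ,
    lintegral_const_mul' _ _ ENNReal.ofReal_ne_top] at h
  rw [h, ← mul_assoc, ← ENNReal.ofReal_mul (by positivity), inv_mul_cancel₀ (by positivity)]
  simp

theorem lintegral_abs_mul_exp_neg_sq_div_four :
    ∫⁻ u : ℝ, ENNReal.ofReal (|u| * Real.exp (-u ^ 2 / 4)) = 4 := by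
  have hint : Integrable fun u : ℝ => |u| * Real.exp (-u ^ 2 / 4) := by
    refine ((integrable_mul_exp_neg_mul_sq (b := 1 / 4) (by norm_num)).abs).congr
      (ae_of_all _ fun u => ?_)
    simp only [abs_mul, abs_of_pos (Real.exp_pos _)]
    ring_nf
  rw [← ofReal_integral_eq_lintegral_ofReal hint (ae_of_all _ fun u => by positivity)]
  have h1 := integral_comp_abs (f := fun u : ℝ => u * Real.exp (-u ^ 2 / 4))
  simp only [sq_abs] at h1
  have h2 := integral_rpow_mul_exp_neg_mul_rpow (p := 2) (q := 1) (b := 1 / 4)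
    (by norm_num) (by norm_num) (by norm_num)
  have h3 : ∫ u in Ioi (0 : ℝ), u * Real.exp (-u ^ 2 / 4) = 2 := by
    calc _ = _ := by
          refine setIntegral_congr_fun measurableSet_Ioi fun u _ => ?_
          show _ = u ^ (1 : ℝ) * Real.exp (-(1 / 4) * u ^ (2 : ℝ))
          rw [Real.rpow_one, Real.rpow_two]
          ring_nf
      _ = _ := h2
      _ = 2 := by norm_num [Real.rpow_neg_one]
  rw [h1, h3]
  norm_num

theorem lintegral_gaussianReal_zero_one (g : ℝ → ℝ≥0∞) :
    ∫⁻ x, g x ∂(gaussianReal 0 1) = ∫⁻ x, gaussianPDF 0 1 x * g x := by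
  rw [gaussianReal_of_var_ne_zero 0 one_ne_zero,
    lintegral_withDensity_eq_lintegral_mul_non_measurable _ (measurable_gaussianPDF 0 1)
      (ae_of_all _ fun _ => gaussianPDF_lt_top)]
  rfl

theorem gaussianPDF_zero_one (x : ℝ) :
    gaussianPDF 0 1 x = ENNReal.ofReal ((√(2 * π))⁻¹ * Real.exp (-x ^ 2 / 2)) := by
  simp [gaussianPDF, gaussianPDFReal]

theorem lintegral_pi_fin_three {μ : Measure ℝ} [SigmaFinite μ] {F : ℝ → ℝ → ℝ → ℝ≥0∞}
    (hF : Measurable fun p : ℝ × ℝ × ℝ => F p.1 p.2.1 p.2.2) :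
    ∫⁻ a : Fin 3 → ℝ, F (a 0) (a 1) (a 2) ∂(Measure.pi fun _ => μ)
      = ∫⁻ y, ∫⁻ x, ∫⁻ u, F u x y ∂μ ∂μ ∂μ := by
  have h1 := measurePreserving_piFinSuccAbove (fun _ : Fin 3 => μ) 0
  have h2 := (MeasurePreserving.id μ).prod (measurePreserving_finTwoArrow μ)
  have h3 := (h2.comp h1).lintegral_comp hF
  refine Eq.trans ?_ (h3.trans ?_)
  · rfl
  · rw [lintegral_prod_symm _ hF.aemeasurable, lintegral_prod_symm]
    exact hF.lintegral_prod_left'.aemeasurable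

/-- The Kac–Rice intensity of the zeros of `(a₀ + m) + a₁ √2 t + (a₂ + m) t²` at `t`. -/
theorem lintegral_intensity (m t : ℝ) :
    ∫⁻ y, ∫⁻ x, gaussianPDF 0 1 y * (gaussianPDF 0 1 x *
        (ENNReal.ofReal |x * √2 + 2 * (y + m) * t| *
          gaussianPDF 0 1 (-(m + x * √2 * t + (y + m) * t ^ 2))))
      = ENNReal.ofReal (√2 / (π * (1 + t ^ 2)) * Real.exp (-m ^ 2 / 2)) := by
  have h2 : √2 * √2 = 2 := Real.mul_self_sqrt (by norm_num)
  have hπ : √(2 * π) * √(2 * π) = 2 * π := Real.mul_self_sqrt (by positivity)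
  have ht : 0 < 1 + t ^ 2 := by positivity
  set C : ℝ := (2 * π)⁻¹ * Real.exp (-m ^ 2 / 2) with hC
  set G : ℝ → ℝ → ℝ≥0∞ := fun y u =>
    ENNReal.ofReal C * ENNReal.ofReal (|u| * Real.exp (-u ^ 2 / 4)) *
      gaussianPDF 0 1 ((1 + t ^ 2) * y + (m * t ^ 2 - t * u)) with hG
  have hpoint : ∀ y x, gaussianPDF 0 1 y * (gaussianPDF 0 1 x *
        (ENNReal.ofReal |x * √2 + 2 * (y + m) * t| *
          gaussianPDF 0 1 (-(m + x * √2 * t + (y + m) * t ^ 2))))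
      = G y (√2 * x + 2 * (y + m) * t) := fun y x => by
    simp only [hG, hC, gaussianPDF_zero_one]
    rw [← ENNReal.ofReal_mul (by positivity), ← ENNReal.ofReal_mul (by positivity),
      ← ENNReal.ofReal_mul (by positivity), ← ENNReal.ofReal_mul (by positivity),
      ← ENNReal.ofReal_mul (by positivity)]
    congr 1
    have hexp : Real.exp (-y ^ 2 / 2) * Real.exp (-x ^ 2 / 2) *
          Real.exp (-(-(m + x * √2 * t + (y + m) * t ^ 2)) ^ 2 / 2)
        = Real.exp (-m ^ 2 / 2) * Real.exp (-(√2 * x + 2 * (y + m) * t) ^ 2 / 4) *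
          Real.exp (-((1 + t ^ 2) * y + (m * t ^ 2 - t * (√2 * x + 2 * (y + m) * t))) ^ 2 / 2) := by
      simp only [← Real.exp_add]
      congr 1
      linear_combination (1 / 4) * x ^ 2 * h2
    have hinv : (√(2 * π))⁻¹ * (√(2 * π))⁻¹ = (2 * π)⁻¹ := by rw [← mul_inv, hπ]
    rw [mul_comm x √2] at *
    linear_combination (√(2 * π))⁻¹ ^ 3 * |√2 * x + 2 * (y + m) * t| * hexp +
      Real.exp (-m ^ 2 / 2) * Real.exp (-(√2 * x + 2 * (y + m) * t) ^ 2 / 4) *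
        Real.exp (-((1 + t ^ 2) * y + (m * t ^ 2 - t * (√2 * x + 2 * (y + m) * t))) ^ 2 / 2) *
        |√2 * x + 2 * (y + m) * t| * (√(2 * π))⁻¹ * hinv
  have hGm : Measurable (Function.uncurry G) := by
    simp only [hG, Function.uncurry_def]
    fun_prop
  have hinner : ∀ u, ∫⁻ y, G y u = ENNReal.ofReal C *
      ENNReal.ofReal (|u| * Real.exp (-u ^ 2 / 4)) * ENNReal.ofReal (1 + t ^ 2)⁻¹ := fun u => by
    simp only [hG]
    rw [lintegral_const_mul' _ _ (by finiteness), lintegral_comp_affine ht.ne',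
      lintegral_gaussianPDF_eq_one 0 one_ne_zero, mul_one, abs_of_pos ht]
  simp only [hpoint]
  simp only [lintegral_comp_affine (show √2 ≠ 0 by positivity)]
  rw [lintegral_const_mul' _ _ (by finiteness), lintegral_lintegral_swap hGm.aemeasurable]
  simp only [hinner]
  rw [lintegral_mul_const' _ _ (by finiteness), lintegral_const_mul' _ _ (by finiteness),
    lintegral_abs_mul_exp_neg_sq_div_four, ← ENNReal.ofReal_ofNat 4,
    ← ENNReal.ofReal_mul (by positivity), ← ENNReal.ofReal_mul (by positivity),
    ← ENNReal.ofReal_mul (by positivity), abs_of_pos (show 0 < √2 by positivity)]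
  congr 1
  simp only [hC]
  field_simp
  linear_combination -2 * h2

theorem lintegral_encard_zeros (m : ℝ) {I : Set ℝ} (hI : MeasurableSet I) :
    ∫⁻ a : Fin 3 → ℝ,
        ({t : ℝ | t ∈ I ∧
          (a 0 + m) + a 1 * √2 * t + (a 2 + m) * t ^ 2 = 0}.encard : ℝ≥0∞)
        ∂(Measure.pi fun _ => gaussianReal 0 1)
      = ∫⁻ t in I, ENNReal.ofReal (√2 / (π * (1 + t ^ 2)) * Real.exp (-m ^ 2 / 2)) := by
  rw [lintegral_pi_fin_three (F := fun u x y =>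
    ({t : ℝ | t ∈ I ∧ (u + m) + x * √2 * t + (y + m) * t ^ 2 = 0}.encard : ℝ≥0∞))
    (measurable_encard_quadratic hI (by fun_prop) (by fun_prop) (by fun_prop))]
  simp only [lintegral_gaussianReal_zero_one]
  simp only [mul_comm (gaussianPDF 0 1 _) (ENat.toENNReal _),
    lintegral_encard_quadratic_mul hI _ _ _ (measurable_gaussianPDF 0 1)]
  simp only [← lintegral_const_mul' _ _ gaussianPDF_ne_top]
  calc _ = ∫⁻ y, ∫⁻ t in I, ∫⁻ x, gaussianPDF 0 1 y * (gaussianPDF 0 1 x *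
        (ENNReal.ofReal |x * √2 + 2 * (y + m) * t| *
          gaussianPDF 0 1 (-(m + x * √2 * t + (y + m) * t ^ 2)))) := by
        refine lintegral_congr fun y => lintegral_lintegral_swap (Measurable.aemeasurable ?_)
        simp only [Function.uncurry_def]
        fun_prop
    _ = ∫⁻ t in I, ∫⁻ y, ∫⁻ x, gaussianPDF 0 1 y * (gaussianPDF 0 1 x *
        (ENNReal.ofReal |x * √2 + 2 * (y + m) * t| *
          gaussianPDF 0 1 (-(m + x * √2 * t + (y + m) * t ^ 2)))) := by
        refine lintegral_lintegral_swap (Measurable.aemeasurable ?_)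
        simp only [Function.uncurry_def]
        refine Measurable.lintegral_prod_right' (f := fun q : (ℝ × ℝ) × ℝ =>
          gaussianPDF 0 1 q.1.1 * (gaussianPDF 0 1 q.2 *
            (ENNReal.ofReal |q.2 * √2 + 2 * (q.1.1 + m) * q.1.2| *
              gaussianPDF 0 1 (-(m + q.2 * √2 * q.1.2 + (q.1.1 + m) * q.1.2 ^ 2))))) ?_
        fun_prop
    _ = _ := by simp only [lintegral_intensity]

theorem lintegral_intensity_univ (m : ℝ) :
    ∫⁻ t : ℝ, ENNReal.ofReal (√2 / (π * (1 + t ^ 2)) * Real.exp (-m ^ 2 / 2))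
      = ENNReal.ofReal (√2 * Real.exp (-m ^ 2 / 2)) := by
  have h : (fun t : ℝ => √2 / (π * (1 + t ^ 2)) * Real.exp (-m ^ 2 / 2))
      = fun t => √2 / π * Real.exp (-m ^ 2 / 2) * (1 + t ^ 2)⁻¹ := by
    funext t
    field_simp
  rw [← ofReal_integral_eq_lintegral_ofReal
      (by rw [h]; exact integrable_inv_one_add_sq.const_mul _) (ae_of_all _ fun t => by positivity),
    h, integral_const_mul, integral_univ_inv_one_add_sq]
  congr 1
  field_simp

/-- Example 1 of Section 5.3: for independent standard normals `a₀, a₁, a₂` and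
`m ∈ ℝ`, the random quadratic `(a₀+m) + a₁√2 t + (a₂+m)t²` has `√2 e^{-m²/2}` expected
real zeros, with density `(√2/(π(1+t²))) e^{-m²/2}`. -/
theorem noncentral_quadratic (m : ℝ) :
    (∀ I : Set ℝ, MeasurableSet I →
      ∫⁻ a : Fin 3 → ℝ,
          ({t : ℝ | t ∈ I ∧
            (a 0 + m) + a 1 * Real.sqrt 2 * t + (a 2 + m) * t ^ 2 = 0}.encard : ℝ≥0∞)
          ∂(Measure.pi fun _ => gaussianReal 0 1)
        = ∫⁻ t in I, ENNReal.ofReal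
            (Real.sqrt 2 / (π * (1 + t ^ 2)) * Real.exp (-m ^ 2 / 2))) ∧
    ∫⁻ a : Fin 3 → ℝ,
        ({t : ℝ |
          (a 0 + m) + a 1 * Real.sqrt 2 * t + (a 2 + m) * t ^ 2 = 0}.encard : ℝ≥0∞)
        ∂(Measure.pi fun _ => gaussianReal 0 1)
      = ENNReal.ofReal (Real.sqrt 2 * Real.exp (-m ^ 2 / 2)) := by
  refine ⟨fun I hI => lintegral_encard_zeros m hI, ?_⟩
  have h := lintegral_encard_zeros m MeasurableSet.univ
  simp only [mem_univ, true_and, setLIntegral_univ] at h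
  rw [h, lintegral_intensity_univ]
end
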